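/- arXiv:2403.07686 — 2 statements merged into one kernel-verified Lean document; each statement's English description precedes it below -/
import Mathlib

section
/- Let X be a stratified space over a poset P, p ∈ P, and N ⊆ X a neighborhood of the stratum X_p, equipped with the induced stratification. Then the inclusion Hol^s_p(N) → Hol^s_p(X) is a diagrammatic equivalence of stratified spaces over P_{>p}, i.e. it induces weak homotopy equivalences on all generalized homotopy links. -/
open Set unitInterval

noncomputable section

/-! ### Stratified spaces over a poset -/

/-- Continuity into the Alexandrov topology on a preordered set: preimages of
upper sets are open. -/
def AlexContinuous {P : Type*} [Preorder P] {X : Type*} [TopologicalSpace X] (s : X → P) : Prop :=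
  ∀ U : Set P, IsUpperSet U → IsOpen (s ⁻¹' U)

lemma stdSimplex.exists_pos' {n : ℕ} (x : stdSimplex ℝ (Fin (n + 1))) :
    ∃ i, 0 < (x : Fin (n + 1) → ℝ) i := by
  by_contra h
  push_neg at h
  have h1 : ∑ i, (x : Fin (n + 1) → ℝ) i = 1 := x.2.2
  have h2 : ∑ i, (x : Fin (n + 1) → ℝ) i ≤ 0 := Finset.sum_nonpos fun i _ => h i
  linarith

/-- The largest index with positive barycentric coordinate. -/
def maxSupp {n : ℕ} (x : stdSimplex ℝ (Fin (n + 1))) : Fin (n + 1) :=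
  (Finset.univ.filter fun i => 0 < (x : Fin (n + 1) → ℝ) i).max' (by
    obtain ⟨i, hi⟩ := stdSimplex.exists_pos' x
    exact ⟨i, Finset.mem_filter.2 ⟨Finset.mem_univ i, hi⟩⟩)

/-- The stratification of the realized stratified simplex `|Δ^J|` of a flag `J`. -/
def flagStrat {P : Type*} {n : ℕ} (J : Fin (n + 1) → P) (x : stdSimplex ℝ (Fin (n + 1))) : P :=
  J (maxSupp x)

/-- The `k`-th horn of the standard `n`-simplex, as a subset of the simplex. -/
def hornSet (n : ℕ) (k : Fin (n + 1)) : Set (stdSimplex ℝ (Fin (n + 1))) :=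
  {x | ∃ i, i ≠ k ∧ (x : Fin (n + 1) → ℝ) i = 0}

/-- `X` (stratified by `s`) has the horn filling property with respect to the
realized stratified horn inclusion `|Λ^J_k| ↪ |Δ^J|`. -/
def HornFilling {P : Type*} {X : Type*} [TopologicalSpace X] (s : X → P) {n : ℕ}
    (J : Fin (n + 1) → P) (k : Fin (n + 1)) : Prop :=
  ∀ f : hornSet n k → X, Continuous f →
    (∀ y : hornSet n k, s (f y) = flagStrat J y.1) →
    ∃ g : stdSimplex ℝ (Fin (n + 1)) → X, Continuous g ∧
      (∀ x, s (g x) = flagStrat J x) ∧ ∀ y : hornSet n k, g y.1 = f y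

/-- `(J, k)` is an inner horn datum. -/
def IsInner (n : ℕ) (k : Fin (n + 1)) : Prop := 0 < (k : ℕ) ∧ (k : ℕ) < n

/-- `(J, k)` is an admissible horn datum. -/
def IsAdmissible {P : Type*} {n : ℕ} (J : Fin (n + 1) → P) (k : Fin (n + 1)) : Prop :=
  IsInner n k ∨
    ((k : ℕ) = 0 ∧ ∃ h : 0 < n, J ⟨0, Nat.succ_pos n⟩ = J ⟨1, Nat.succ_lt_succ h⟩) ∨
    ((k : ℕ) = n ∧ ∃ _h : 0 < n, J ⟨n - 1, by omega⟩ = J ⟨n, Nat.lt_succ_self n⟩)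

/-- A stratified space is categorically fibrant if it has the horn filling property
with respect to all inner stratified horn inclusions. -/
def CatFibrant {P : Type*} [Preorder P] {X : Type*} [TopologicalSpace X] (s : X → P) : Prop :=
  ∀ (n : ℕ) (J : Fin (n + 1) → P), Monotone J → ∀ k : Fin (n + 1), IsInner n k → HornFilling s J k

/-- A stratified space is diagrammatically fibrant if it has the horn filling property
with respect to all admissible stratified horn inclusions. -/
def DiagFibrant {P : Type*} [Preorder P] {X : Type*} [TopologicalSpace X] (s : X → P) : Prop :=
  ∀ (n : ℕ) (J : Fin (n + 1) → P), Monotone J → ∀ k : Fin (n + 1), IsAdmissible J k →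
    HornFilling s J k

/-! ### Exit paths and refinedness -/

/-- An exit path: `s ∘ γ` is constant on `(0, 1]` and does not decrease from `γ 0`. -/
def IsExitPath {P : Type*} [Preorder P] {X : Type*} [TopologicalSpace X]
    (s : X → P) (γ : C(I, X)) : Prop :=
  (∀ t t' : I, t ≠ 0 → t' ≠ 0 → s (γ t) = s (γ t')) ∧ ∀ t : I, s (γ 0) ≤ s (γ t)

/-- One step in a chain of exit paths. -/
def ExitStep {P : Type*} [Preorder P] {X : Type*} [TopologicalSpace X] (s : X → P)
    (x y : X) : Prop :=
  ∃ γ : C(I, X), IsExitPath s γ ∧ γ 0 = x ∧ γ 1 = y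

/-- A stratified space is refined if its stratification is surjective and the order
relation is exactly detected by finite chains of exit paths. -/
def IsRefined {P : Type*} [Preorder P] {X : Type*} [TopologicalSpace X] (s : X → P) : Prop :=
  Function.Surjective s ∧ ∀ x y : X, s x ≤ s y ↔ Relation.ReflTransGen (ExitStep s) x y

/-- The frontier relation: the `p`-stratum meets the closure of the `q`-stratum. -/
def FrontierRel {P : Type*} {X : Type*} [TopologicalSpace X] (s : X → P) (p q : P) : Prop :=
  (s ⁻¹' {p} ∩ closure (s ⁻¹' {q})).Nonempty

/-- Weakly frontier stratified. -/
def WeaklyFrontierStratified {P : Type*} [Preorder P] {X : Type*} [TopologicalSpace X]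
    (s : X → P) : Prop :=
  Function.Surjective s ∧ ∀ p q : P, p ≤ q ↔ Relation.ReflTransGen (FrontierRel s) p q

/-- Frontier stratified. -/
def FrontierStratified {P : Type*} [Preorder P] {X : Type*} [TopologicalSpace X]
    (s : X → P) : Prop :=
  WeaklyFrontierStratified s ∧ ∀ p q : P, FrontierRel s p q → s ⁻¹' {p} ⊆ closure (s ⁻¹' {q})

/-! ### Homotopy links -/

lemma I_one_ne_zero : (1 : I) ≠ 0 := fun h => one_ne_zero (α := ℝ) (congrArg Subtype.val h)

/-- The pairwise homotopy link of the pair of strata `p`, `q`. -/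
abbrev PairHolink {P : Type*} {X : Type*} [TopologicalSpace X] (s : X → P) (p q : P) :=
  {γ : C(I, X) // s (γ 0) = p ∧ ∀ t : I, t ≠ 0 → s (γ t) = q}

/-- Starting point evaluation on the pairwise homotopy link. -/
def pairHolinkEv0 {P : Type*} {X : Type*} [TopologicalSpace X] (s : X → P) (p q : P)
    (γ : PairHolink s p q) : {x : X // s x = p} :=
  ⟨γ.1 0, γ.2.1⟩

/-- A Serre fibration: a map with the homotopy lifting property with respect to all
Euclidean disks. -/
def IsSerreFibration {E B : Type*} [TopologicalSpace E] [TopologicalSpace B] (π : E → B) : Prop :=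
  ∀ (n : ℕ)
    (H : ↥(Metric.closedBall (0 : EuclideanSpace ℝ (Fin n)) 1) × I → B)
    (h₀ : ↥(Metric.closedBall (0 : EuclideanSpace ℝ (Fin n)) 1) → E),
    Continuous H → Continuous h₀ → (∀ d, π (h₀ d) = H (d, 0)) →
    ∃ G : ↥(Metric.closedBall (0 : EuclideanSpace ℝ (Fin n)) 1) × I → E,
      Continuous G ∧ (∀ d, G (d, 0) = h₀ d) ∧ ∀ z, π (G z) = H z

/-- The stratified homotopy link of the stratum `p`: exit paths starting in the
`p`-stratum and immediately leaving it. -/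
abbrev StratHolink {P : Type*} [Preorder P] {X : Type*} [TopologicalSpace X]
    (s : X → P) (p : P) :=
  {γ : C(I, X) // s (γ 0) = p ∧ (∀ t : I, t ≠ 0 → p < s (γ t)) ∧
    ∀ t t' : I, t ≠ 0 → t' ≠ 0 → s (γ t) = s (γ t')}

/-- The stratification of the stratified homotopy link over `P_{>p}`. -/
def stratHolinkStrat {P : Type*} [Preorder P] {X : Type*} [TopologicalSpace X]
    (s : X → P) (p : P) (γ : StratHolink s p) : {q : P // p < q} :=
  ⟨s (γ.1 1), γ.2.2.1 1 I_one_ne_zero⟩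

/-- Endpoint evaluation on the stratified homotopy link. -/
def stratHolinkEv1 {P : Type*} [Preorder P] {X : Type*} [TopologicalSpace X]
    (s : X → P) (p : P) (γ : StratHolink s p) : {x : X // p < s x} :=
  ⟨γ.1 1, γ.2.2.1 1 I_one_ne_zero⟩

/-- The generalized homotopy link of a (regular) flag `Iflag`: the space of stratified
maps `|Δ^Iflag| → X`, topologized via the compact-open topology. -/
abbrev Holink {P : Type*} {X : Type*} [TopologicalSpace X] (s : X → P) {m : ℕ}
    (Iflag : Fin (m + 1) → P) :=
  {f : C(stdSimplex ℝ (Fin (m + 1)), X) // ∀ x, s (f x) = flagStrat Iflag x}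

/-! ### Weak homotopy equivalences -/

/-- The boundary of the `n`-cube. -/
def cubeBoundary (n : ℕ) : Set (Fin n → I) := {y | ∃ i, y i = 0 ∨ y i = 1}

/-- Generalized loops: maps of the `n`-cube collapsing the boundary to the basepoint. -/
abbrev GenLoops (n : ℕ) (X : Type*) [TopologicalSpace X] (x : X) :=
  {p : C((Fin n → I), X) // ∀ y ∈ cubeBoundary n, p y = x}

/-- Homotopy rel boundary as a setoid on generalized loops. -/
def genLoopSetoid (n : ℕ) (X : Type*) [TopologicalSpace X] (x : X) :
    Setoid (GenLoops n X x) where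
  r p q := p.1.HomotopicRel q.1 (cubeBoundary n)
  iseqv := ⟨fun p => ContinuousMap.HomotopicRel.refl p.1,
    fun h => h.symm, fun h h' => h.trans h'⟩

/-- The `n`-th homotopy group (as a type) of `X` at `x`. -/
def HtpyGroup (n : ℕ) (X : Type*) [TopologicalSpace X] (x : X) :=
  Quotient (genLoopSetoid n X x)

/-- The map induced by a continuous map on homotopy groups. -/
def htpyGroupMap (n : ℕ) {X Y : Type*} [TopologicalSpace X] [TopologicalSpace Y]
    (f : C(X, Y)) (x : X) : HtpyGroup n X x → HtpyGroup n Y (f x) :=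
  Quotient.map (fun p => ⟨f.comp p.1, fun y hy => by
      simp [ContinuousMap.comp_apply, p.2 y hy]⟩)
    (fun p q h => h.map fun F => F.compContinuousMap f)

/-- The map induced by a continuous map on path components. -/
def pi0Map {X Y : Type*} [TopologicalSpace X] [TopologicalSpace Y] (f : C(X, Y)) :
    ZerothHomotopy X → ZerothHomotopy Y :=
  Quotient.map f fun _ _ h => ⟨h.somePath.map f.continuous⟩

/-- A weak homotopy equivalence: a continuous map inducing a bijection on path
components and isomorphisms on all homotopy groups at all basepoints. -/
def IsWeakHomotopyEquiv {X Y : Type*} [TopologicalSpace X] [TopologicalSpace Y]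
    (f : C(X, Y)) : Prop :=
  Function.Bijective (pi0Map f) ∧
    ∀ (n : ℕ) (x : X), Function.Bijective (htpyGroupMap (n + 1) f x)

/-! ### Induced maps and diagrammatic equivalences -/

/-- The map induced on generalized homotopy links by a stratified map. -/
def holinkCMap {P : Type*} {X Y : Type*} [TopologicalSpace X] [TopologicalSpace Y]
    (sX : X → P) (sY : Y → P) (w : C(X, Y)) (hw : ∀ x, sY (w x) = sX x)
    {m : ℕ} (Iflag : Fin (m + 1) → P) :
    C(Holink sX Iflag, Holink sY Iflag) :=
  ⟨fun f => ⟨w.comp f.1, fun x => by simp [ContinuousMap.comp_apply, hw, f.2 x]⟩,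
    Continuous.subtype_mk
      ((ContinuousMap.continuous_postcomp w).comp continuous_subtype_val) _⟩

/-- A stratified map is a diagrammatic equivalence if it induces weak homotopy
equivalences on all generalized homotopy links. -/
def IsDiagEquiv {P : Type*} [Preorder P] {X Y : Type*} [TopologicalSpace X] [TopologicalSpace Y]
    (sX : X → P) (sY : Y → P) (w : C(X, Y)) (hw : ∀ x, sY (w x) = sX x) : Prop :=
  ∀ (m : ℕ) (Iflag : Fin (m + 1) → P), StrictMono Iflag →
    IsWeakHomotopyEquiv (holinkCMap sX sY w hw Iflag)

/-- The restriction of a stratified map to the `q`-stratum. -/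
def stratumCMap {Q : Type*} {X Y : Type*} [TopologicalSpace X] [TopologicalSpace Y]
    (sX : X → Q) (sY : Y → Q) (w : C(X, Y)) (hw : ∀ x, sY (w x) = sX x) (q : Q) :
    C({x : X // sX x = q}, {y : Y // sY y = q}) :=
  ⟨fun x => ⟨w x.1, by rw [hw x.1]; exact x.2⟩,
    Continuous.subtype_mk (w.continuous.comp continuous_subtype_val)
      fun x => by show sY (w x.1) = q; rw [hw x.1]; exact x.2⟩

/-- The map induced on stratified homotopy links by a stratified map. -/
def stratHolinkCMap {P : Type*} [Preorder P] {X Y : Type*} [TopologicalSpace X]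
    [TopologicalSpace Y] {sX : X → P} {sY : Y → P} (w : C(X, Y))
    (hw : ∀ x, sY (w x) = sX x) (p : P) :
    C(StratHolink sX p, StratHolink sY p) :=
  ⟨fun γ => ⟨w.comp γ.1,
      by simpa [ContinuousMap.comp_apply, hw] using γ.2.1,
      fun t ht => by simpa [ContinuousMap.comp_apply, hw] using γ.2.2.1 t ht,
      fun t t' ht ht' => by simpa [ContinuousMap.comp_apply, hw] using γ.2.2.2 t t' ht ht'⟩,
    Continuous.subtype_mk
      ((ContinuousMap.continuous_postcomp w).comp continuous_subtype_val) _⟩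

lemma stratHolinkCMap_strat {P : Type*} [Preorder P] {X Y : Type*} [TopologicalSpace X]
    [TopologicalSpace Y] {sX : X → P} {sY : Y → P} (w : C(X, Y))
    (hw : ∀ x, sY (w x) = sX x) (p : P) (γ : StratHolink sX p) :
    stratHolinkStrat sY p (stratHolinkCMap w hw p γ) = stratHolinkStrat sX p γ :=
  Subtype.ext (hw _)

/-- The local homotopy link of `X` at `x ∈ X_p`: the fiber of the stratified homotopy
link over `x`. -/
abbrev LocalHolink {P : Type*} [Preorder P] {X : Type*} [TopologicalSpace X]
    (s : X → P) (p : P) (x : X) :=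
  {γ : StratHolink s p // (γ.1 : C(I, X)) 0 = x}

/-- The stratification of the local homotopy link over `P_{>p}`. -/
def localHolinkStrat {P : Type*} [Preorder P] {X : Type*} [TopologicalSpace X]
    (s : X → P) (p : P) (x : X) (γ : LocalHolink s p x) : {q : P // p < q} :=
  stratHolinkStrat s p γ.1

/-- The map induced on local homotopy links by a stratified map. -/
def localHolinkCMap {P : Type*} [Preorder P] {X Y : Type*} [TopologicalSpace X]
    [TopologicalSpace Y] {sX : X → P} {sY : Y → P} (w : C(X, Y))
    (hw : ∀ x, sY (w x) = sX x) (p : P) (x : X) :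
    C(LocalHolink sX p x, LocalHolink sY p (w x)) :=
  ⟨fun γ => ⟨stratHolinkCMap w hw p γ.1, by
      show (w.comp γ.1.1) 0 = w x
      simp [ContinuousMap.comp_apply, γ.2]⟩,
    Continuous.subtype_mk
      ((stratHolinkCMap w hw p).continuous.comp continuous_subtype_val)
      fun γ => by
        show (w.comp γ.1.1) 0 = w x
        simp [ContinuousMap.comp_apply, γ.2]⟩

lemma localHolinkCMap_strat {P : Type*} [Preorder P] {X Y : Type*} [TopologicalSpace X]
    [TopologicalSpace Y] {sX : X → P} {sY : Y → P} (w : C(X, Y))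
    (hw : ∀ x, sY (w x) = sX x) (p : P) (x : X) (γ : LocalHolink sX p x) :
    localHolinkStrat sY p (w x) (localHolinkCMap w hw p x γ) = localHolinkStrat sX p x γ :=
  Subtype.ext (hw _)

end

/-! ### Compact deformations and weak homotopy equivalences -/

namespace CubeCollar

/-- A homotopy of the interval, relative to its endpoints as a set, from the identity to the map
collapsing the two outer thirds to the endpoints. -/
noncomputable def stretch : C(I × I, I) :=
  ⟨fun z => projIcc (0 : ℝ) 1 zero_le_one ((1 + 2 * (z.1 : ℝ)) * z.2 - z.1), by fun_prop⟩

lemma stretch_zero_left (t : I) : stretch (0, t) = t := by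
  simp [stretch]

lemma stretch_zero (τ : I) : stretch (τ, 0) = 0 :=
  projIcc_of_le_left zero_le_one (by simpa using τ.2.1)

lemma stretch_one (τ : I) : stretch (τ, 1) = 1 :=
  projIcc_of_right_le zero_le_one (by have := τ.2.1; simp only [Icc.coe_one]; linarith)

/-- The coordinatewise version of `stretch` on the cube. -/
noncomputable def cubeStretch (n : ℕ) : C(I × (Fin n → I), Fin n → I) :=
  ⟨fun z i => stretch (z.1, z.2 i), by fun_prop⟩

lemma cubeStretch_apply {n : ℕ} (τ : I) (y : Fin n → I) (i : Fin n) :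
    cubeStretch n (τ, y) i = stretch (τ, y i) := rfl

lemma cubeStretch_mem_cubeBoundary {n : ℕ} (τ : I) {y : Fin n → I} (hy : y ∈ cubeBoundary n) :
    cubeStretch n (τ, y) ∈ cubeBoundary n := by
  obtain ⟨i, hi | hi⟩ := hy
  · exact ⟨i, Or.inl (by rw [cubeStretch_apply, hi, stretch_zero])⟩
  · exact ⟨i, Or.inr (by rw [cubeStretch_apply, hi, stretch_one])⟩

/-- The collapse of the outer collar of the cube onto the boundary. -/
noncomputable def collapse (n : ℕ) : C(Fin n → I, Fin n → I) :=
  (cubeStretch n).comp ⟨fun y => (1, y), by fun_prop⟩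

lemma collapse_apply {n : ℕ} (y : Fin n → I) (i : Fin n) :
    collapse n y i = stretch (1, y i) := rfl

lemma collapse_mem_cubeBoundary {n : ℕ} {y : Fin n → I} (hy : y ∈ cubeBoundary n) :
    collapse n y ∈ cubeBoundary n :=
  cubeStretch_mem_cubeBoundary 1 hy

/-- A bump function vanishing at the endpoints and equal to `1` on the middle third. -/
noncomputable def bump : C(I, I) :=
  ⟨fun t => projIcc (0 : ℝ) 1 zero_le_one (3 * min (t : ℝ) (1 - t)), by fun_prop⟩

lemma bump_zero : bump 0 = 0 := by
  exact projIcc_of_le_left zero_le_one (by simp)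

lemma bump_one : bump 1 = 0 := by
  exact projIcc_of_le_left zero_le_one (by simp)

lemma bump_eq_one {t : I} (h0 : stretch (1, t) ≠ 0) (h1 : stretch (1, t) ≠ 1) : bump t = 1 := by
  have h0' : (0 : ℝ) < (1 + 2 * 1) * t - 1 := by
    by_contra! h
    exact h0 (projIcc_of_le_left zero_le_one (by simpa using h))
  have h1' : ((1 + 2 * 1) * t - 1 : ℝ) < 1 := by
    by_contra! h
    exact h1 (projIcc_of_right_le zero_le_one (by simpa using h))
  refine projIcc_of_right_le zero_le_one ?_
  rcases min_cases (t : ℝ) (1 - t) with h | h <;> rw [h.1] <;> linarith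

/-- The product of the bump functions of the coordinates. -/
noncomputable def cubeBump (n : ℕ) : C(Fin n → I, I) :=
  ⟨fun y => ∏ i, bump (y i), by fun_prop⟩

lemma cubeBump_eq_zero {n : ℕ} {y : Fin n → I} (hy : y ∈ cubeBoundary n) : cubeBump n y = 0 := by
  obtain ⟨i, hi⟩ := hy
  refine Finset.prod_eq_zero (Finset.mem_univ i) ?_
  rcases hi with hi | hi <;> rw [hi]
  exacts [bump_zero, bump_one]

lemma cubeBump_eq_one {n : ℕ} {y : Fin n → I} (hy : collapse n y ∉ cubeBoundary n) :
    cubeBump n y = 1 :=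
  Finset.prod_eq_one (s := Finset.univ) (f := fun i => bump (y i)) fun i _ =>
    bump_eq_one (fun h => hy ⟨i, Or.inl h⟩) (fun h => hy ⟨i, Or.inr h⟩)

lemma genLoop_homotopicRel_comp_collapse {n : ℕ} {X : Type*} [TopologicalSpace X] {x : X}
    (g : C(Fin n → I, X)) (hg : ∀ y ∈ cubeBoundary n, g y = x) :
    g.HomotopicRel (g.comp (collapse n)) (cubeBoundary n) :=
  ⟨{ toContinuousMap := g.comp (cubeStretch n)
     map_zero_left := fun y => congrArg g (funext fun i => stretch_zero_left (y i))
     map_one_left := fun _ => rfl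
     prop' := fun τ y hy =>
       (hg _ (cubeStretch_mem_cubeBoundary τ hy)).trans (hg y hy).symm }⟩

end CubeCollar

open CubeCollar

/-- Every cube in `B` can be deformed into `A` by a deformation of `B` preserving `A`. -/
def HasCubeDeformations {A B : Type*} [TopologicalSpace A] [TopologicalSpace B]
    (f : C(A, B)) : Prop :=
  ∀ (n : ℕ) (g : C(Fin n → I, B)), ∃ D : C(I × B, B), (∀ b, D (0, b) = b) ∧
    (∀ τ a, D (τ, f a) ∈ range f) ∧ ∀ y, D (1, g y) ∈ range f

namespace HasCubeDeformations

variable {A B : Type*} [TopologicalSpace A] [TopologicalSpace B] {f : C(A, B)}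

lemma exists_lift (hD : HasCubeDeformations f) (hf : Topology.IsEmbedding f) {n : ℕ}
    (g : C(Fin n → I, B)) (hg : ∀ y ∈ cubeBoundary n, g y ∈ range f) :
    ∃ G : C(Fin n → I, A),
      (g.comp (collapse n)).HomotopicRel (f.comp G) (cubeBoundary n) := by
  obtain ⟨D, hD0, hDA, hD1⟩ := hD n g
  have hmem : ∀ y, D (cubeBump n y, g (collapse n y)) ∈ range f := by
    intro y
    by_cases hy : collapse n y ∈ cubeBoundary n
    · obtain ⟨a, ha⟩ := hg _ hy
      rw [← ha]
      exact hDA _ a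
    · rw [cubeBump_eq_one hy]
      exact hD1 _
  choose G hG using hmem
  have hGc : Continuous G := by
    rw [hf.isInducing.continuous_iff, show f ∘ G = _ from funext hG]
    fun_prop
  exact ⟨⟨G, hGc⟩,
    ⟨{ toFun := fun z => D (z.1 * cubeBump n z.2, g (collapse n z.2))
       continuous_toFun := by fun_prop
       map_zero_left := fun y => by simp [hD0]
       map_one_left := fun y => by simp [hG]
       prop' := fun τ y hy => by simp [cubeBump_eq_zero hy, hD0] }⟩⟩

lemma surjective_pi0Map (hD : HasCubeDeformations f) : Function.Surjective (pi0Map f) := by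
  rintro ⟨b⟩
  obtain ⟨D, hD0, -, hD1⟩ := hD 0 (ContinuousMap.const _ b)
  obtain ⟨a, ha⟩ := hD1 0
  refine ⟨Quotient.mk _ a, Quotient.sound ⟨Path.symm ?_⟩⟩
  exact { toFun := fun τ => D (τ, b)
          continuous_toFun := by fun_prop
          source' := hD0 b
          target' := ha.symm }

lemma injective_pi0Map (hD : HasCubeDeformations f) (hf : Topology.IsEmbedding f) :
    Function.Injective (pi0Map f) := by
  rintro ⟨a₀⟩ ⟨a₁⟩ h
  obtain ⟨γ⟩ : Joined (f a₀) (f a₁) := Quotient.exact h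
  obtain ⟨G, ⟨F⟩⟩ := hD.exists_lift hf
    (⟨fun y : Fin 1 → I => γ (y 0), by fun_prop⟩ : C(Fin 1 → I, B)) (by
      rintro y ⟨i, hi⟩
      rw [Subsingleton.elim i 0] at hi
      rcases hi with hi | hi
      · exact ⟨a₀, by simp [hi]⟩
      · exact ⟨a₁, by simp [hi]⟩)
  have hG0 := F.fst_eq_snd (x := fun _ => 0) ⟨0, Or.inl rfl⟩
  have hG1 := F.fst_eq_snd (x := fun _ => 1) ⟨0, Or.inr rfl⟩
  refine Quotient.sound ⟨⟨⟨fun t => G fun _ => t, by fun_prop⟩, hf.injective ?_, hf.injective ?_⟩⟩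
  · simpa [collapse_apply, stretch_zero] using hG0.symm
  · simpa [collapse_apply, stretch_one] using hG1.symm

lemma surjective_htpyGroupMap (hD : HasCubeDeformations f) (hf : Topology.IsEmbedding f)
    (n : ℕ) (a : A) : Function.Surjective (htpyGroupMap n f a) := by
  rintro ⟨g, hg⟩
  obtain ⟨G, hG⟩ := hD.exists_lift hf g fun y hy => ⟨a, (hg y hy).symm⟩
  have hGa : ∀ y ∈ cubeBoundary n, G y = a := fun y hy => by
    obtain ⟨F⟩ := hG
    exact hf.injective ((F.fst_eq_snd hy).symm.trans (hg _ (collapse_mem_cubeBoundary hy)))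
  refine ⟨Quotient.mk _ ⟨G, hGa⟩, Quotient.sound ?_⟩
  exact ((genLoop_homotopicRel_comp_collapse g hg).trans hG).symm

lemma injective_htpyGroupMap (hD : HasCubeDeformations f) (hf : Topology.IsEmbedding f)
    (n : ℕ) (a : A) : Function.Injective (htpyGroupMap n f a) := by
  rintro ⟨g₀, hg₀⟩ ⟨g₁, hg₁⟩ h
  obtain ⟨H⟩ : (f.comp g₀).HomotopicRel (f.comp g₁) (cubeBoundary n) := Quotient.exact h
  obtain ⟨G, ⟨F⟩⟩ := hD.exists_lift hf
    (⟨fun y : Fin (n + 1) → I => H (y 0, Fin.tail y), by unfold Fin.tail; fun_prop⟩ :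
      C(Fin (n + 1) → I, B)) (by
      rintro y ⟨i, hi⟩
      cases i using Fin.cases with
      | zero =>
        rcases hi with hi | hi
        · exact ⟨g₀ (Fin.tail y), by simp [hi]⟩
        · exact ⟨g₁ (Fin.tail y), by simp [hi]⟩
      | succ j =>
        have hy : Fin.tail y ∈ cubeBoundary n := ⟨j, hi⟩
        exact ⟨g₀ (Fin.tail y), (H.eq_fst _ hy).symm⟩)
  have hval : ∀ (t : I) (y : Fin n → I), (Fin.cons t y : Fin (n + 1) → I) ∈ cubeBoundary (n + 1) →
      f (G (Fin.cons t y)) = H (stretch (1, t), collapse n y) :=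
    fun t y hy => (F.fst_eq_snd hy).symm
  have h₀ : ∀ y, G (Fin.cons 0 y) = g₀ (collapse n y) := fun y => hf.injective <| by
    rw [hval 0 y ⟨0, Or.inl rfl⟩, stretch_zero]
    simp
  have h₁ : ∀ y, G (Fin.cons 1 y) = g₁ (collapse n y) := fun y => hf.injective <| by
    rw [hval 1 y ⟨0, Or.inr rfl⟩, stretch_one]
    simp
  have hmid : (g₀.comp (collapse n)).HomotopicRel (g₁.comp (collapse n)) (cubeBoundary n) :=
    ⟨{ toFun := fun z => G (Fin.cons z.1 z.2)
       continuous_toFun := G.continuous.comp (Continuous.finCons continuous_fst continuous_snd)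
       map_zero_left := h₀
       map_one_left := h₁
       prop' := fun t y hy => hf.injective <| by
         obtain ⟨j, hj⟩ := id hy
         exact (hval t y ⟨j.succ, hj⟩).trans (H.eq_fst _ (collapse_mem_cubeBoundary hy)) }⟩
  exact Quotient.sound (((genLoop_homotopicRel_comp_collapse g₀ hg₀).trans hmid).trans
    (genLoop_homotopicRel_comp_collapse g₁ hg₁).symm)

theorem isWeakHomotopyEquiv (hD : HasCubeDeformations f) (hf : Topology.IsEmbedding f) :
    IsWeakHomotopyEquiv f :=
  ⟨⟨hD.injective_pi0Map hf, hD.surjective_pi0Map⟩, fun n a =>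
    ⟨hD.injective_htpyGroupMap hf (n + 1) a, hD.surjective_htpyGroupMap hf (n + 1) a⟩⟩

end HasCubeDeformations

/-! ### Shrinking exit paths -/

section Shrink

variable {P : Type*} [Preorder P] {X : Type*} [TopologicalSpace X]

/-- Restricting an exit path to `[0, u]` and rescaling. -/
def stratHolinkShrink (s : X → P) (p : P) :
    C({u : I // u ≠ 0} × StratHolink s p, StratHolink s p) where
  toFun z := ⟨z.2.1.comp ⟨fun t => z.1.1 * t, by fun_prop⟩, by simpa using z.2.2.1,
    fun t ht => z.2.2.2.1 _ (mul_ne_zero z.1.2 ht),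
    fun t t' ht ht' => z.2.2.2.2 _ _ (mul_ne_zero z.1.2 ht) (mul_ne_zero z.1.2 ht')⟩
  continuous_toFun := by
    refine Continuous.subtype_mk (ContinuousMap.continuous_of_continuous_uncurry _ ?_) _
    change Continuous fun w : ({u : I // u ≠ 0} × StratHolink s p) × I =>
      w.1.2.1 (w.1.1.1 * w.2)
    fun_prop

lemma stratHolinkStrat_shrink (s : X → P) (p : P) (u : {u : I // u ≠ 0})
    (γ : StratHolink s p) :
    stratHolinkStrat s p (stratHolinkShrink s p (u, γ)) = stratHolinkStrat s p γ :=
  Subtype.ext (γ.2.2.2 _ _ (mul_ne_zero u.2 I_one_ne_zero) I_one_ne_zero)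

/-- The affine path from `1` to `ε` in `(0, 1]`. -/
def shrinkPath (ε : {u : I // u ≠ 0}) : C(I, {u : I // u ≠ 0}) where
  toFun τ := ⟨σ (τ * σ ε.1), fun h => by
    have h1 : τ * σ ε.1 = 1 := by simpa using congrArg σ h
    have h2 : σ ε.1 = 1 := le_antisymm le_one' (h1 ▸ mul_le_right)
    exact ε.2 (by simpa using congrArg σ h2)⟩
  continuous_toFun := by fun_prop

lemma shrinkPath_zero (ε : {u : I // u ≠ 0}) : (shrinkPath ε 0).1 = 1 := by
  simp [shrinkPath]

lemma shrinkPath_one (ε : {u : I // u ≠ 0}) : (shrinkPath ε 1).1 = ε.1 := by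
  simp [shrinkPath]

/-- The deformation of a generalized homotopy link shrinking all exit paths to `[0, ε]`. -/
def holinkShrink (s : X → P) (p : P) {m : ℕ} (J : Fin (m + 1) → {q : P // p < q})
    (ε : {u : I // u ≠ 0}) :
    C(I × Holink (stratHolinkStrat s p) J, Holink (stratHolinkStrat s p) J) where
  toFun z := ⟨⟨fun x => stratHolinkShrink s p (shrinkPath ε z.1, z.2.1 x), by fun_prop⟩,
    fun x => (stratHolinkStrat_shrink s p _ _).trans (z.2.2 x)⟩
  continuous_toFun := by
    refine Continuous.subtype_mk (ContinuousMap.continuous_of_continuous_uncurry _ ?_) _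
    change Continuous fun w : (I × Holink (stratHolinkStrat s p) J) × _ =>
      stratHolinkShrink s p (shrinkPath ε w.1.1, w.1.2.1 w.2)
    fun_prop

lemma holinkShrink_apply (s : X → P) (p : P) {m : ℕ} (J : Fin (m + 1) → {q : P // p < q})
    (ε : {u : I // u ≠ 0}) (τ : I) (b : Holink (stratHolinkStrat s p) J)
    (x : stdSimplex ℝ (Fin (m + 1))) (t : I) :
    ((holinkShrink s p J ε (τ, b)).1 x).1 t = (b.1 x).1 ((shrinkPath ε τ).1 * t) := rfl

variable (s : X → P) (p : P) (N : Set X)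

/-- The inclusion `Hol_p(N) → Hol_p(X)`. -/
abbrev stratHolinkIncl : C(StratHolink (fun x : N => s x.1) p, StratHolink s p) :=
  stratHolinkCMap ⟨Subtype.val, continuous_subtype_val⟩ (fun _ => rfl) p

lemma isEmbedding_stratHolinkIncl : Topology.IsEmbedding (stratHolinkIncl s p N) := by
  have h : Topology.IsEmbedding fun γ : StratHolink (fun x : N => s x.1) p =>
      (⟨Subtype.val, continuous_subtype_val⟩ : C(N, X)).comp γ.1 :=
    (ContinuousMap.isEmbedding_postcomp (⟨Subtype.val, continuous_subtype_val⟩ : C(N, X))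
      .subtypeVal).comp .subtypeVal
  exact Topology.IsEmbedding.of_comp (stratHolinkIncl s p N).continuous continuous_subtype_val h

variable {m : ℕ} (J : Fin (m + 1) → {q : P // p < q})

/-- The map induced by the inclusion of `N` on generalized homotopy links of `Hol_p`. -/
abbrev holinkIncl : C(Holink (stratHolinkStrat (fun x : N => s x.1) p) J,
    Holink (stratHolinkStrat s p) J) :=
  holinkCMap _ _ (stratHolinkIncl s p N) (stratHolinkCMap_strat _ _ p) J

lemma isEmbedding_holinkIncl : Topology.IsEmbedding (holinkIncl s p N J) := by
  have h : Topology.IsEmbedding fun b : Holink (stratHolinkStrat (fun x : N => s x.1) p) J =>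
      (stratHolinkIncl s p N).comp b.1 :=
    (ContinuousMap.isEmbedding_postcomp _ (isEmbedding_stratHolinkIncl s p N)).comp .subtypeVal
  exact Topology.IsEmbedding.of_comp (holinkIncl s p N J).continuous continuous_subtype_val h

variable {s p N J}

lemma mem_range_holinkIncl {b : Holink (stratHolinkStrat s p) J} :
    b ∈ range (holinkIncl s p N J) ↔ ∀ x t, (b.1 x).1 t ∈ N := by
  constructor
  · rintro ⟨a, rfl⟩ x t
    exact ((a.1 x).1 t).2
  · intro h
    have hc : Continuous fun x =>
        (⟨⟨fun t => ⟨(b.1 x).1 t, h x t⟩, by fun_prop⟩, (b.1 x).2⟩ :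
          StratHolink (fun x : N => s x.1) p) :=
      (isEmbedding_stratHolinkIncl s p N).isInducing.continuous_iff.2 b.1.continuous
    exact ⟨⟨⟨_, hc⟩, b.2⟩, rfl⟩

lemma exists_forall_mul_mem {K : Type*} [TopologicalSpace K] [CompactSpace K]
    (hN : s ⁻¹' {p} ⊆ interior N) (g : C(K, Holink (stratHolinkStrat s p) J)) :
    ∃ ε : {u : I // u ≠ 0}, ∀ k x t, ((g k).1 x).1 (ε.1 * t) ∈ N := by
  have hc : Continuous fun z : I × K × stdSimplex ℝ (Fin (m + 1)) => ((g z.2.1).1 z.2.2).1 z.1 := by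
    fun_prop
  obtain ⟨U, V, hU, -, h0, hV, hUV⟩ := generalized_tube_lemma (isCompact_singleton (x := (0 : I)))
    (isCompact_univ (X := K × stdSimplex ℝ (Fin (m + 1)))) (isOpen_interior.preimage hc) (by
      rintro ⟨t, k, x⟩ ⟨rfl, -⟩
      exact hN ((g k).1 x).2.1)
  obtain ⟨δ, hδ, hball⟩ := Metric.isOpen_iff.1 hU 0 (h0 rfl)
  have hε : (0 : ℝ) < min (δ / 2) 1 := by positivity
  refine ⟨⟨⟨min (δ / 2) 1, hε.le, min_le_right _ _⟩, fun h => hε.ne' (congrArg Subtype.val h)⟩,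
    fun k x t => interior_subset (hUV (mk_mem_prod (hball ?_) (hV (mem_univ (k, x)))))⟩
  rw [Metric.mem_ball, Subtype.dist_eq, Real.dist_eq]
  have h1 : min (δ / 2) 1 * (t : ℝ) ≤ min (δ / 2) 1 := mul_le_of_le_one_right hε.le t.2.2
  have h2 : 0 ≤ min (δ / 2) 1 * (t : ℝ) := mul_nonneg hε.le t.2.1
  have h3 : min (δ / 2) 1 ≤ δ / 2 := min_le_left _ _
  simp only [Icc.coe_mul, Icc.coe_zero, sub_zero]
  rw [abs_of_nonneg h2]
  linarith

lemma hasCubeDeformations_holinkIncl (hN : s ⁻¹' {p} ⊆ interior N) :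
    HasCubeDeformations (holinkIncl s p N J) := by
  intro n g
  obtain ⟨ε, hε⟩ := exists_forall_mul_mem hN g
  refine ⟨holinkShrink s p J ε, fun b => ?_, fun τ a => ?_, fun y => ?_⟩
  · ext x t
    rw [holinkShrink_apply, shrinkPath_zero, one_mul]
  · exact mem_range_holinkIncl.2 fun x t => by
      rw [holinkShrink_apply]
      exact mem_range_holinkIncl.1 (mem_range_self a) x _
  · exact mem_range_holinkIncl.2 fun x t => by
      rw [holinkShrink_apply, shrinkPath_one]
      exact hε y x t

end Shrink

/-- **Stratified homotopy links are computed by neighborhoods of the stratum.** If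
`N ⊆ X` is a neighborhood of the stratum `X_p` (with the induced stratification),
then the inclusion `Hol^s_p(N) → Hol^s_p(X)` is a diagrammatic equivalence of
stratified spaces over `P_{>p}`. -/
theorem stratHolink_nbhd_diag_equiv {P : Type} [PartialOrder P] {X : Type}
    [TopologicalSpace X] (s : X → P) (hs : AlexContinuous s) (p : P)
    (N : Set X) (hN : s ⁻¹' {p} ⊆ interior N) :
    IsDiagEquiv (stratHolinkStrat (fun x : N => s x.1) p) (stratHolinkStrat s p)
      (stratHolinkCMap (⟨Subtype.val, continuous_subtype_val⟩ : C(N, X))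
        (fun _ => rfl) p)
      (stratHolinkCMap_strat _ _ p) := by
  intro m J _
  exact (hasCubeDeformations_holinkIncl hN).isWeakHomotopyEquiv (isEmbedding_holinkIncl s p N J)
end

section
/- Let w : X → Y be a stratified map of stratified spaces over a poset P. Then w is a diagrammatic equivalence if and only if for each p ∈ P both of the following hold: (i) the restriction w_p : X_p → Y_p to the p-strata is a weak homotopy equivalence, and (ii) the induced map of stratified homotopy links Hol^s_p(X) → Hol^s_p(Y) is a diagrammatic equivalence of stratified spaces over P_{>p}. -/
open Set unitInterval

/-! ### Radial rescaling of cubes and change of basepoint -/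

section ChangeOfBasepoint

/-- The distance of a point of the cube from its centre, normalized to be `1` on the boundary. -/
noncomputable def cubeRadius {n : ℕ} (y : Fin n → I) : ℝ := ‖fun i => 2 * (y i : ℝ) - 1‖

@[fun_prop]
lemma continuous_cubeRadius {n : ℕ} : Continuous (cubeRadius (n := n)) := by
  unfold cubeRadius
  fun_prop

lemma cubeRadius_eq_one {n : ℕ} {y : Fin n → I} (hy : y ∈ cubeBoundary n) :
    cubeRadius y = 1 := by
  apply le_antisymm
  · refine (pi_norm_le_iff_of_nonneg zero_le_one).2 fun i => ?_
    have h0 := (y i).2.1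
    have h1 := (y i).2.2
    rw [Real.norm_eq_abs, abs_le]
    constructor <;> linarith
  · obtain ⟨i, hi⟩ := hy
    refine le_trans ?_ (norm_le_pi_norm (fun i => 2 * (y i : ℝ) - 1) i)
    rcases hi with hi | hi <;> norm_num [hi]

/-- Rescaling the cube about its centre by the factor `c`, followed by clamping. -/
noncomputable def cubeScale {n : ℕ} (c : ℝ) (y : Fin n → I) : Fin n → I :=
  fun i => projIcc 0 1 zero_le_one (1 / 2 + c * ((y i : ℝ) - 1 / 2))

@[fun_prop]
lemma Continuous.cubeScale {n : ℕ} {Z : Type*} [TopologicalSpace Z] {c : Z → ℝ}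
    {y : Z → Fin n → I} (hc : Continuous c) (hy : Continuous y) :
    Continuous fun z => cubeScale (c z) (y z) :=
  continuous_pi fun i => continuous_projIcc.comp (by fun_prop)

lemma cubeScale_one {n : ℕ} (y : Fin n → I) : cubeScale 1 y = y := by
  funext i
  have : (1 / 2 + 1 * ((y i : ℝ) - 1 / 2)) = y i := by ring
  rw [cubeScale, this, projIcc_val]

lemma cubeScale_mem_cubeBoundary {n : ℕ} {c : ℝ} {y : Fin n → I} (hc : 0 ≤ c)
    (h : 1 ≤ c * cubeRadius y) : cubeScale c y ∈ cubeBoundary n := by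
  have hnorm : c * cubeRadius y = ‖fun i => c * (2 * (y i : ℝ) - 1)‖ := by
    rw [cubeRadius, ← Real.norm_of_nonneg hc, ← norm_smul, Real.norm_of_nonneg hc]
    rfl
  obtain ⟨i, hi⟩ : ∃ i, 1 ≤ |c * (2 * (y i : ℝ) - 1)| := by
    by_contra! hlt
    rw [hnorm] at h
    exact absurd ((pi_norm_lt_iff zero_lt_one).2 hlt) (not_lt.2 h)
  refine ⟨i, ?_⟩
  rcases le_abs.1 hi with hi | hi
  · right
    exact projIcc_of_right_le _ (by linarith)
  · left
    exact projIcc_of_le_left _ (by linarith)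

/-- The radial coordinate on the collar `1/2 ≤ cubeRadius y ≤ 1`, running from `1` to `0`. -/
noncomputable def collarCoord {n : ℕ} (y : Fin n → I) : I :=
  projIcc 0 1 zero_le_one (2 - 2 * cubeRadius y)

@[fun_prop]
lemma continuous_collarCoord {n : ℕ} : Continuous (collarCoord (n := n)) :=
  continuous_projIcc.comp (by fun_prop)

lemma collarCoord_eq_zero {n : ℕ} {y : Fin n → I} (hy : y ∈ cubeBoundary n) :
    collarCoord y = 0 :=
  projIcc_of_le_left _ (by rw [cubeRadius_eq_one hy]; norm_num)

lemma collarCoord_eq_one {n : ℕ} {y : Fin n → I} (hy : cubeRadius y ≤ 1 / 2) :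
    collarCoord y = 1 :=
  projIcc_of_right_le _ (by linarith)

variable {A B : Type*} [TopologicalSpace A] [TopologicalSpace B] {n : ℕ}

lemma continuous_collar {Z : Type*} [TopologicalSpace Z] (γ : C(I, A)) {r : Z × (Fin n → I) → A}
    (hr : Continuous r) (hb : ∀ z, ∀ y ∈ cubeBoundary n, r (z, y) = γ 1) :
    Continuous fun z : Z × (Fin n → I) =>
      if cubeRadius z.2 ≤ 1 / 2 then r (z.1, cubeScale 2 z.2) else γ (collarCoord z.2) := by
  refine Continuous.if_le (by fun_prop) (by fun_prop) (by fun_prop) continuous_const ?_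
  intro z hz
  rw [hb _ _ (cubeScale_mem_cubeBoundary zero_le_two (by rw [hz]; norm_num)),
    collarCoord_eq_one hz.le]

/-- Transport of a generalized loop at `γ 1` to one at `γ 0`, by inserting `γ` radially in a
collar of the boundary. -/
noncomputable def collar (γ : C(I, A)) (r : C(Fin n → I, A))
    (hr : ∀ y ∈ cubeBoundary n, r y = γ 1) : C(Fin n → I, A) where
  toFun y := if cubeRadius y ≤ 1 / 2 then r (cubeScale 2 y) else γ (collarCoord y)
  continuous_toFun :=
    (continuous_collar (Z := Unit) γ (r := fun z => r z.2) (by fun_prop) fun _ => hr).comp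
      (by fun_prop : Continuous fun y => ((), y))

lemma collar_boundary (γ : C(I, A)) (r : C(Fin n → I, A))
    (hr : ∀ y ∈ cubeBoundary n, r y = γ 1) {y : Fin n → I} (hy : y ∈ cubeBoundary n) :
    collar γ r hr y = γ 0 := by
  show (if cubeRadius y ≤ 1 / 2 then r (cubeScale 2 y) else γ (collarCoord y)) = γ 0
  rw [if_neg (by rw [cubeRadius_eq_one hy]; norm_num), collarCoord_eq_zero hy]

lemma collar_homotopicRel (γ : C(I, A)) {r r' : C(Fin n → I, A)}
    (hr : ∀ y ∈ cubeBoundary n, r y = γ 1) (hr' : ∀ y ∈ cubeBoundary n, r' y = γ 1)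
    (h : r.HomotopicRel r' (cubeBoundary n)) :
    (collar γ r hr).HomotopicRel (collar γ r' hr') (cubeBoundary n) := by
  obtain ⟨F⟩ := h
  have hF : ∀ t, ∀ y ∈ cubeBoundary n, F (t, y) = γ 1 := fun t y hy => by
    rw [F.eq_fst t hy, hr y hy]
  refine ⟨{ toFun := _, continuous_toFun := continuous_collar γ F.continuous hF,
            map_zero_left := ?_, map_one_left := ?_, prop' := ?_ }⟩
  · intro y
    simp [collar]
  · intro y
    simp [collar]
  · intro t y hy
    have : ¬ cubeRadius y ≤ 1 / 2 := by rw [cubeRadius_eq_one hy]; norm_num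
    simp only [ContinuousMap.coe_mk, collar, if_neg this]

lemma comp_collar (f : C(A, B)) (γ : C(I, A)) (r : C(Fin n → I, A))
    (hr : ∀ y ∈ cubeBoundary n, r y = γ 1) (hr' : ∀ y ∈ cubeBoundary n, f.comp r y = f.comp γ 1) :
    f.comp (collar γ r hr) = collar (f.comp γ) (f.comp r) hr' := by
  ext y
  exact apply_ite f _ _ _

/-- The track of a point under a homotopy. -/
def homotopyTrack {f g : C(A, B)} (H : f.Homotopy g) (a : A) : C(I, B) :=
  H.toContinuousMap.comp ((ContinuousMap.id I).prodMk (ContinuousMap.const I a))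

/-- Deforming a generalized loop along a homotopy and transporting back along the track of the
basepoint does not change its class. -/
lemma homotopicRel_collar {T : C(A, A)} (H : (ContinuousMap.id A).Homotopy T) {a : A}
    {p : C(Fin n → I, A)} (hp : ∀ y ∈ cubeBoundary n, p y = a)
    (hp' : ∀ y ∈ cubeBoundary n, T.comp p y = homotopyTrack H a 1) :
    p.HomotopicRel (collar (homotopyTrack H a) (T.comp p) hp') (cubeBoundary n) := by
  refine ⟨{ toFun := fun z => H (min z.1 (collarCoord z.2), p (cubeScale (1 + z.1) z.2)),
            continuous_toFun := by fun_prop,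
            map_zero_left := ?_, map_one_left := ?_, prop' := ?_ }⟩
  · intro y
    simp [cubeScale_one]
  · intro y
    have h2 : (1 + ((1 : I) : ℝ)) = 2 := by norm_num
    have h1 : min 1 (collarCoord y) = collarCoord y := min_eq_right le_one'
    simp only [h1, h2]
    show _ = if cubeRadius y ≤ 1 / 2 then T (p (cubeScale 2 y)) else H (collarCoord y, a)
    split_ifs with h
    · rw [collarCoord_eq_one h, H.apply_one]
    · rw [hp _ (cubeScale_mem_cubeBoundary zero_le_two (by linarith))]
  · intro t y hy
    have h1 : min t (collarCoord y) = 0 := by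
      rw [collarCoord_eq_zero hy]; exact min_eq_right nonneg'
    have ht := t.2.1
    show H (min t (collarCoord y), p (cubeScale (1 + t) y)) = p y
    rw [h1, H.apply_zero, hp y hy, hp _ (cubeScale_mem_cubeBoundary (by linarith) (by
      rw [cubeRadius_eq_one hy]; linarith))]
    rfl

end ChangeOfBasepoint

/-! ### Weak homotopy equivalences under homotopy retracts of maps -/

section Retract

lemma isWeakHomotopyEquiv_iff {X Y : Type*} [TopologicalSpace X] [TopologicalSpace Y]
    (f : C(X, Y)) :
    IsWeakHomotopyEquiv f ↔
      ((∀ a b, Joined (f a) (f b) → Joined a b) ∧ ∀ y, ∃ a, Joined (f a) y) ∧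
      ∀ (n : ℕ) (x : X),
        (∀ p q : C(Fin (n + 1) → I, X), (∀ y ∈ cubeBoundary (n + 1), p y = x) →
          (∀ y ∈ cubeBoundary (n + 1), q y = x) →
          (f.comp p).HomotopicRel (f.comp q) (cubeBoundary (n + 1)) →
          p.HomotopicRel q (cubeBoundary (n + 1))) ∧
        ∀ q : C(Fin (n + 1) → I, Y), (∀ y ∈ cubeBoundary (n + 1), q y = f x) →
          ∃ p : C(Fin (n + 1) → I, X), (∀ y ∈ cubeBoundary (n + 1), p y = x) ∧
            (f.comp p).HomotopicRel q (cubeBoundary (n + 1)) := by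
  refine and_congr (and_congr ?_ ?_) (forall₂_congr fun n x => and_congr ?_ ?_)
  · constructor
    · intro h a b hab
      exact Quotient.exact (h (a₁ := Quotient.mk _ a) (a₂ := Quotient.mk _ b) (Quotient.sound hab))
    · rintro h ⟨a⟩ ⟨b⟩ hab
      exact Quotient.sound (h a b (Quotient.exact hab))
  · constructor
    · intro h y
      obtain ⟨⟨a⟩, ha⟩ := h (Quotient.mk _ y)
      exact ⟨a, Quotient.exact ha⟩
    · rintro h ⟨y⟩
      obtain ⟨a, ha⟩ := h y
      exact ⟨Quotient.mk _ a, Quotient.sound ha⟩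
  · constructor
    · intro h p q hp hq hpq
      exact Quotient.exact (s := genLoopSetoid (n + 1) X x)
        (h (a₁ := Quotient.mk _ ⟨p, hp⟩) (a₂ := Quotient.mk _ ⟨q, hq⟩)
          (Quotient.sound (s := genLoopSetoid (n + 1) Y (f x)) hpq))
    · rintro h ⟨p, hp⟩ ⟨q, hq⟩ hpq
      exact Quotient.sound (s := genLoopSetoid (n + 1) X x)
        (h p q hp hq (Quotient.exact (s := genLoopSetoid (n + 1) Y (f x)) hpq))
  · constructor
    · intro h q hq
      obtain ⟨⟨p, hp⟩, hpq⟩ := h (Quotient.mk _ ⟨q, hq⟩)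
      exact ⟨p, hp, Quotient.exact (s := genLoopSetoid (n + 1) Y (f x)) hpq⟩
    · rintro h ⟨q, hq⟩
      obtain ⟨p, hp, hpq⟩ := h q hq
      exact ⟨Quotient.mk _ ⟨p, hp⟩, Quotient.sound (s := genLoopSetoid (n + 1) Y (f x)) hpq⟩

/-- A map which is a retract of a weak homotopy equivalence, up to homotopies compatible with the
map, is a weak homotopy equivalence. -/
lemma IsWeakHomotopyEquiv.of_homotopy_retract {A B A' B' : Type*}
    [TopologicalSpace A] [TopologicalSpace B] [TopologicalSpace A'] [TopologicalSpace B']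
    {f : C(A, B)} {f' : C(A', B')} (hf' : IsWeakHomotopyEquiv f')
    {cA : C(A, A')} {jA : C(A', A)} {cB : C(B, B')} {jB : C(B', B)}
    (hc : f'.comp cA = cB.comp f) (hj : f.comp jA = jB.comp f')
    (HA : (ContinuousMap.id A).Homotopy (jA.comp cA))
    (HB : (ContinuousMap.id B).Homotopy (jB.comp cB))
    (hH : ∀ t a, f (HA (t, a)) = HB (t, f a)) :
    IsWeakHomotopyEquiv f := by
  rw [isWeakHomotopyEquiv_iff] at hf' ⊢
  have hc' : ∀ a, f' (cA a) = cB (f a) := fun a => DFunLike.congr_fun hc a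
  have hj' : ∀ a, f (jA a) = jB (f' a) := fun a => DFunLike.congr_fun hj a
  have joinA : ∀ a, Joined a (jA (cA a)) := fun a =>
    ⟨⟨homotopyTrack HA a, HA.apply_zero a, HA.apply_one a⟩⟩
  have joinB : ∀ b, Joined b (jB (cB b)) := fun b =>
    ⟨⟨homotopyTrack HB b, HB.apply_zero b, HB.apply_one b⟩⟩
  refine ⟨⟨fun a b hab => ?_, fun b => ?_⟩, fun n x => ⟨fun p q hp hq hpq => ?_, fun q hq => ?_⟩⟩
  · have h2 : Joined (cA a) (cA b) := hf'.1.1 _ _ (by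
      rw [hc', hc']; exact ⟨hab.somePath.map cB.continuous⟩)
    exact ((joinA a).trans ⟨h2.somePath.map jA.continuous⟩).trans (joinA b).symm
  · obtain ⟨a', ha'⟩ := hf'.1.2 (cB b)
    refine ⟨jA a', ?_⟩
    rw [hj']
    exact Joined.trans ⟨ha'.somePath.map jB.continuous⟩ (joinB b).symm
  · have hcpq : (cA.comp p).HomotopicRel (cA.comp q) (cubeBoundary (n + 1)) := by
      refine (hf'.2 n (cA x)).1 _ _ (fun y hy => congrArg cA (hp y hy))
        (fun y hy => congrArg cA (hq y hy)) ?_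
      rw [← ContinuousMap.comp_assoc, ← ContinuousMap.comp_assoc, hc]
      exact hpq.comp_continuousMap cB
    have key : ∀ r : C(Fin (n + 1) → I, A), (∀ y ∈ cubeBoundary (n + 1), r y = x) →
        ∀ y ∈ cubeBoundary (n + 1), (jA.comp cA).comp r y = homotopyTrack HA x 1 := by
      intro r hr y hy
      exact (congrArg (jA.comp cA) (hr y hy)).trans (HA.apply_one x).symm
    exact ((homotopicRel_collar HA hp (key p hp)).trans
      (collar_homotopicRel _ _ (key q hq) (hcpq.comp_continuousMap jA))).trans
      (homotopicRel_collar HA hq (key q hq)).symm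
  · obtain ⟨r, hr, hrq⟩ := (hf'.2 n (cA x)).2 (cB.comp q) (fun y hy =>
      (congrArg cB (hq y hy)).trans (hc' x).symm)
    have hr1 : ∀ y ∈ cubeBoundary (n + 1), jA.comp r y = homotopyTrack HA x 1 := fun y hy =>
      (congrArg jA (hr y hy)).trans (HA.apply_one x).symm
    have htrack : f.comp (homotopyTrack HA x) = homotopyTrack HB (f x) := by
      ext t
      exact hH t x
    have hq1 : ∀ y ∈ cubeBoundary (n + 1),
        (jB.comp cB).comp q y = homotopyTrack HB (f x) 1 := fun y hy =>
      (congrArg (jB.comp cB) (hq y hy)).trans (HB.apply_one (f x)).symm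
    refine ⟨collar (homotopyTrack HA x) (jA.comp r) hr1,
      fun y hy => (collar_boundary _ _ hr1 hy).trans (HA.apply_zero x), ?_⟩
    have hr2 : ∀ y ∈ cubeBoundary (n + 1),
        f.comp (jA.comp r) y = homotopyTrack HB (f x) 1 := fun y hy => by
      rw [← htrack]
      exact congrArg f (hr1 y hy)
    rw [comp_collar f _ _ hr1 (fun y hy => congrArg f (hr1 y hy))]
    refine ContinuousMap.HomotopicRel.trans ?_ (homotopicRel_collar HB hq hq1).symm
    have := collar_homotopicRel (homotopyTrack HB (f x)) hr2 hq1 (by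
      rw [← ContinuousMap.comp_assoc, hj]
      exact hrq.comp_continuousMap jB)
    convert this using 2

end Retract
/-! ### The simplex as a quotient of a prism -/

section Prism

variable {n : ℕ}

lemma maxSupp_eq_iff (x : stdSimplex ℝ (Fin (n + 1))) (i : Fin (n + 1)) :
    maxSupp x = i ↔ 0 < x i ∧ ∀ j, i < j → x j = 0 := by
  rw [maxSupp, Finset.max'_eq_iff]
  simp only [Finset.mem_filter, Finset.mem_univ, true_and]
  refine and_congr Iff.rfl (forall_congr' fun j => ⟨fun h hij => ?_, fun h hj => ?_⟩)
  · exact le_antisymm (not_lt.1 fun hj => absurd (h hj) (not_le.2 hij)) (x.2.1 j)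
  · exact not_lt.1 fun hij => hj.ne' (h hij)

lemma maxSupp_pos (x : stdSimplex ℝ (Fin (n + 1))) : 0 < x (maxSupp x) :=
  ((maxSupp_eq_iff x _).1 rfl).1

lemma eq_zero_of_maxSupp_lt (x : stdSimplex ℝ (Fin (n + 1))) {j : Fin (n + 1)}
    (hj : maxSupp x < j) : x j = 0 :=
  ((maxSupp_eq_iff x _).1 rfl).2 j hj

/-- The segment between two points of the simplex. -/
def simplexMix (s : I) (x y : stdSimplex ℝ (Fin (n + 1))) : stdSimplex ℝ (Fin (n + 1)) :=
  ⟨fun i => (1 - (s : ℝ)) * x i + s * y i,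
    fun i => add_nonneg (mul_nonneg (sub_nonneg.2 s.2.2) (x.2.1 i)) (mul_nonneg s.2.1 (y.2.1 i)),
    by
      rw [Finset.sum_add_distrib, ← Finset.mul_sum, ← Finset.mul_sum, stdSimplex.sum_eq_one x, stdSimplex.sum_eq_one y]
      ring⟩

lemma simplexMix_zero (x y : stdSimplex ℝ (Fin (n + 1))) : simplexMix 0 x y = x := by
  ext i
  show (1 - ((0 : I) : ℝ)) * x i + ((0 : I) : ℝ) * y i = x i
  simp

lemma simplexMix_one (x y : stdSimplex ℝ (Fin (n + 1))) : simplexMix 1 x y = y := by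
  ext i
  show (1 - ((1 : I) : ℝ)) * x i + ((1 : I) : ℝ) * y i = y i
  simp

lemma maxSupp_simplexMix (s : I) {x y : stdSimplex ℝ (Fin (n + 1))} (h : maxSupp y = maxSupp x) :
    maxSupp (simplexMix s x y) = maxSupp x := by
  rw [maxSupp_eq_iff]
  have hx := maxSupp_pos x
  have hy := maxSupp_pos y
  rw [h] at hy
  constructor
  · show 0 < (1 - (s : ℝ)) * x (maxSupp x) + s * y (maxSupp x)
    rcases s.2.1.eq_or_lt with hs | hs
    · rw [← hs]; linarith
    · exact add_pos_of_nonneg_of_pos (mul_nonneg (sub_nonneg.2 s.2.2) hx.le) (mul_pos hs hy)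
  · intro j hj
    show (1 - (s : ℝ)) * x j + s * y j = 0
    rw [eq_zero_of_maxSupp_lt x hj, eq_zero_of_maxSupp_lt y (h ▸ hj)]
    ring

lemma Continuous.stdSimplex_apply {Z : Type*} [TopologicalSpace Z]
    {x : Z → stdSimplex ℝ (Fin (n + 1))} (hx : Continuous x) (i : Fin (n + 1)) :
    Continuous fun z => x z i :=
  (continuous_apply i).comp (continuous_subtype_val.comp hx)

@[fun_prop]
lemma Continuous.simplexMix {Z : Type*} [TopologicalSpace Z] {s : Z → I}
    {x y : Z → stdSimplex ℝ (Fin (n + 1))} (hs : Continuous s) (hx : Continuous x)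
    (hy : Continuous y) : Continuous fun z => simplexMix (s z) (x z) (y z) :=
  Continuous.subtype_mk (continuous_pi fun i =>
    ((continuous_const.sub (continuous_subtype_val.comp hs)).mul (hx.stdSimplex_apply i)).add
      ((continuous_subtype_val.comp hs).mul (hy.stdSimplex_apply i))) _

/-- The point at height `t` on the segment from the initial vertex to the point `x` of the
opposite face. -/
def simplexCone (x : stdSimplex ℝ (Fin (n + 1))) (t : I) : stdSimplex ℝ (Fin (n + 2)) :=
  ⟨Fin.cons (1 - (t : ℝ)) fun i => t * x i,
    fun i => Fin.cases (sub_nonneg.2 t.2.2) (fun i => mul_nonneg t.2.1 (x.2.1 i)) i,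
    by
      rw [Fin.sum_univ_succ]
      simp only [Fin.cons_zero, Fin.cons_succ]
      rw [← Finset.mul_sum, stdSimplex.sum_eq_one x]
      ring⟩

@[simp]
lemma simplexCone_apply_zero (x : stdSimplex ℝ (Fin (n + 1))) (t : I) :
    simplexCone x t 0 = 1 - t := rfl

@[simp]
lemma simplexCone_apply_succ (x : stdSimplex ℝ (Fin (n + 1))) (t : I) (i : Fin (n + 1)) :
    simplexCone x t i.succ = t * x i := rfl

@[fun_prop]
lemma Continuous.simplexCone {Z : Type*} [TopologicalSpace Z]
    {x : Z → stdSimplex ℝ (Fin (n + 1))} {t : Z → I} (hx : Continuous x) (ht : Continuous t) :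
    Continuous fun z => simplexCone (x z) (t z) := by
  refine Continuous.subtype_mk (continuous_pi fun i => ?_) _
  cases i using Fin.cases with
  | zero => simp only [Fin.cons_zero]; fun_prop
  | succ i => exact (continuous_subtype_val.comp ht).mul (hx.stdSimplex_apply i)

lemma maxSupp_simplexCone_zero (x : stdSimplex ℝ (Fin (n + 1))) :
    maxSupp (simplexCone x 0) = 0 := by
  rw [maxSupp_eq_iff]
  refine ⟨by simp, fun j hj => ?_⟩
  obtain ⟨j, rfl⟩ := Fin.exists_succ_eq.2 hj.ne'
  simp

lemma maxSupp_simplexCone (x : stdSimplex ℝ (Fin (n + 1))) {t : I} (ht : t ≠ 0) :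
    maxSupp (simplexCone x t) = (maxSupp x).succ := by
  rw [maxSupp_eq_iff]
  refine ⟨mul_pos (unitInterval.pos_iff_ne_zero.2 ht : (0 : ℝ) < t) (maxSupp_pos x),
    fun j hj => ?_⟩
  obtain ⟨j, rfl⟩ := Fin.exists_succ_eq.2 (ne_of_gt (lt_of_le_of_lt (Fin.zero_le _) hj))
  simp [eq_zero_of_maxSupp_lt x (Fin.succ_lt_succ_iff.1 hj)]

/-- The height of a point of the simplex over its initial vertex. -/
def simplexHeight (y : stdSimplex ℝ (Fin (n + 2))) : I :=
  ⟨1 - y 0, sub_nonneg.2 (stdSimplex.le_one y 0), sub_le_self _ (y.2.1 0)⟩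

/-- The affine map collapsing the first edge of the simplex. -/
def simplexCollapse (y : stdSimplex ℝ (Fin (n + 2))) : stdSimplex ℝ (Fin (n + 1)) :=
  ⟨fun i => y i.succ + if i = 0 then y 0 else 0,
    fun i => add_nonneg (y.2.1 _) (by split_ifs; exacts [y.2.1 0, le_rfl]),
    by
      rw [Finset.sum_add_distrib, Finset.sum_ite_eq' Finset.univ, if_pos (Finset.mem_univ _),
        add_comm, ← Fin.sum_univ_succ (f := fun i => y i), stdSimplex.sum_eq_one y]⟩

lemma simplexCollapse_apply (y : stdSimplex ℝ (Fin (n + 2))) (i : Fin (n + 1)) :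
    simplexCollapse y i = y i.succ + if i = 0 then y 0 else 0 := rfl

@[fun_prop]
lemma Continuous.simplexHeight {Z : Type*} [TopologicalSpace Z]
    {y : Z → stdSimplex ℝ (Fin (n + 2))} (hy : Continuous y) :
    Continuous fun z => simplexHeight (y z) :=
  Continuous.subtype_mk (continuous_const.sub (hy.stdSimplex_apply 0)) _

@[fun_prop]
lemma Continuous.simplexCollapse {Z : Type*} [TopologicalSpace Z]
    {y : Z → stdSimplex ℝ (Fin (n + 2))} (hy : Continuous y) :
    Continuous fun z => simplexCollapse (y z) := by
  refine Continuous.subtype_mk (continuous_pi fun i => (hy.stdSimplex_apply _).add ?_) _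
  split_ifs
  exacts [hy.stdSimplex_apply 0, continuous_const]

lemma simplexHeight_eq_zero_iff (y : stdSimplex ℝ (Fin (n + 2))) :
    simplexHeight y = 0 ↔ maxSupp y = 0 := by
  rw [Subtype.ext_iff, maxSupp_eq_iff]
  show 1 - y 0 = 0 ↔ _
  have hsum := stdSimplex.sum_eq_one y
  rw [Fin.sum_univ_succ] at hsum
  constructor
  · intro h
    refine ⟨by linarith, fun j hj => ?_⟩
    obtain ⟨j, rfl⟩ := Fin.exists_succ_eq.2 hj.ne'
    have hz : ∑ i : Fin (n + 1), y i.succ = 0 := by linarith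
    exact (Finset.sum_eq_zero_iff_of_nonneg fun i _ => y.2.1 (Fin.succ i)).1 hz j
      (Finset.mem_univ _)
  · rintro ⟨-, h⟩
    rw [Finset.sum_eq_zero fun i _ => h _ (Fin.succ_pos i)] at hsum
    linarith

lemma maxSupp_simplexCollapse {y : stdSimplex ℝ (Fin (n + 2))} {i : Fin (n + 1)}
    (h : maxSupp y = i.succ) : maxSupp (simplexCollapse y) = i := by
  rw [maxSupp_eq_iff] at h ⊢
  refine ⟨?_, fun j hj => ?_⟩
  · rw [simplexCollapse_apply]
    refine add_pos_of_pos_of_nonneg h.1 ?_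
    split_ifs
    exacts [y.2.1 0, le_rfl]
  · rw [simplexCollapse_apply, h.2 _ (Fin.succ_lt_succ_iff.2 hj),
      if_neg (ne_of_gt (lt_of_le_of_lt (Fin.zero_le _) hj)), add_zero]

@[simp]
lemma simplexHeight_simplexCone (x : stdSimplex ℝ (Fin (n + 1))) (t : I) :
    simplexHeight (simplexCone x t) = t := by
  ext
  show 1 - (1 - (t : ℝ)) = t
  ring

lemma maxSupp_simplexCollapse_simplexCone (x : stdSimplex ℝ (Fin (n + 1))) {t : I} (ht : t ≠ 0) :
    maxSupp (simplexCollapse (simplexCone x t)) = maxSupp x :=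
  maxSupp_simplexCollapse (maxSupp_simplexCone x ht)

lemma maxSupp_simplexCone_simplexCollapse (y : stdSimplex ℝ (Fin (n + 2))) :
    maxSupp (simplexCone (simplexCollapse y) (simplexHeight y)) = maxSupp y := by
  by_cases h : simplexHeight y = 0
  · rw [h, maxSupp_simplexCone_zero, (simplexHeight_eq_zero_iff y).1 h]
  · rw [maxSupp_simplexCone _ h]
    obtain ⟨i, hi⟩ := Fin.exists_succ_eq.2 fun h' => h ((simplexHeight_eq_zero_iff y).2 h')
    rw [maxSupp_simplexCollapse hi.symm, hi]

lemma flagStrat_fin_one {P : Type*} (K : Fin 1 → P) (x : stdSimplex ℝ (Fin (0 + 1))) :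
    flagStrat K x = K 0 :=
  congrArg K (Fin.fin_one_eq_zero _)

end Prism
/-! ### Generalized homotopy links as homotopy links of stratified homotopy links -/

section HolinkComparison

variable {P X Y Z : Type*} [PartialOrder P] [TopologicalSpace X] [TopologicalSpace Y]
  [TopologicalSpace Z] {m : ℕ} {p : P}

/-- A jointly continuous family of stratified maps from a simplex, as a map to the generalized
homotopy link. -/
def Holink.curry (s : X → P) (J : Fin (m + 1) → P)
    (f : C(Z × stdSimplex ℝ (Fin (m + 1)), X)) (hf : ∀ z x, s (f (z, x)) = flagStrat J x) :
    C(Z, Holink s J) :=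
  ⟨fun z => ⟨f.curry z, hf z⟩, f.curry.continuous.subtype_mk _⟩

/-- A jointly continuous family of maps from a prism sending one end to the `p`-stratum and being
stratified along `J` elsewhere, as a map to the generalized homotopy link of the stratified homotopy
link. -/
def Holink.curryPrism (s : X → P) (J : Fin (m + 1) → {q : P // p < q})
    (f : C((Z × stdSimplex ℝ (Fin (m + 1))) × I, X)) (hf0 : ∀ z, s (f (z, 0)) = p)
    (hf : ∀ z t, t ≠ 0 → s (f (z, t)) = flagStrat J z.2) :
    C(Z, Holink (stratHolinkStrat s p) J) :=
  Holink.curry _ J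
    ⟨fun z => ⟨f.curry z, hf0 z, fun t ht => (flagStrat J z.2).2.trans_eq (hf z t ht).symm,
      fun t t' ht ht' => (hf z t ht).trans (hf z t' ht').symm⟩, f.curry.continuous.subtype_mk _⟩
    fun z x => Subtype.ext (hf (z, x) 1 I_one_ne_zero)

lemma StratHolink.strat_eq {s : X → P} (γ : StratHolink s p) {t : I} (ht : t ≠ 0) :
    s (γ.1 t) = stratHolinkStrat s p γ :=
  γ.2.2.2 t 1 ht I_one_ne_zero

lemma Holink.strat_apply {s : X → P} {J : Fin (m + 1) → {q : P // p < q}}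
    (ψ : Holink (stratHolinkStrat s p) J) (x : stdSimplex ℝ (Fin (m + 1))) {t : I} (ht : t ≠ 0) :
    s ((ψ.1 x).1 t) = J (maxSupp x) :=
  (StratHolink.strat_eq _ ht).trans (congrArg Subtype.val (ψ.2 x))

variable {I' : Fin (m + 2) → P} {J : Fin (m + 1) → {q : P // p < q}}

/-- Precomposition with the quotient map from the prism to the simplex. -/
def holinkToPrism (s : X → P) (h0 : I' 0 = p) (hJ : ∀ i, I' i.succ = J i) :
    C(Holink s I', Holink (stratHolinkStrat s p) J) :=
  Holink.curryPrism s J ⟨fun z => z.1.1.1 (simplexCone z.1.2 z.2), by fun_prop⟩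
    (fun z => by
      show s (z.1.1 (simplexCone z.2 0)) = p
      rw [z.1.2, flagStrat, maxSupp_simplexCone_zero, h0])
    (fun z t ht => by
      show s (z.1.1 (simplexCone z.2 t)) = _
      rw [z.1.2, flagStrat, maxSupp_simplexCone _ ht, hJ]
      rfl)

/-- Precomposition with the stratified map from the simplex to the prism. -/
def holinkOfPrism (s : X → P) (h0 : I' 0 = p) (hJ : ∀ i, I' i.succ = J i) :
    C(Holink (stratHolinkStrat s p) J, Holink s I') :=
  Holink.curry s I' ⟨fun z => (z.1.1 (simplexCollapse z.2)).1 (simplexHeight z.2), by fun_prop⟩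
    (fun ψ y => by
      show s ((ψ.1 (simplexCollapse y)).1 (simplexHeight y)) = _
      rw [flagStrat]
      by_cases h : simplexHeight y = 0
      · rw [h, (simplexHeight_eq_zero_iff y).1 h, h0]
        exact (ψ.1 (simplexCollapse y)).2.1
      · obtain ⟨i, hi⟩ := Fin.exists_succ_eq.2 fun h' => h ((simplexHeight_eq_zero_iff y).2 h')
        rw [Holink.strat_apply ψ _ h, maxSupp_simplexCollapse hi.symm, ← hi, hJ])

/-- The linear homotopy from the identity of the simplex to the passage through the prism. -/
def holinkSimplexHomotopy (s : X → P) (h0 : I' 0 = p) (hJ : ∀ i, I' i.succ = J i) :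
    (ContinuousMap.id (Holink s I')).Homotopy
      ((holinkOfPrism s h0 hJ).comp (holinkToPrism s h0 hJ)) where
  toContinuousMap := Holink.curry s I'
    ⟨fun z => z.1.2.1 (simplexMix z.1.1 z.2 (simplexCone (simplexCollapse z.2)
      (simplexHeight z.2))), by fun_prop⟩
    fun z y => by
      show s (z.2.1 _) = _
      rw [z.2.2, flagStrat, maxSupp_simplexMix _ (maxSupp_simplexCone_simplexCollapse y)]
      rfl
  map_zero_left φ := Subtype.ext <| ContinuousMap.ext fun y =>
    congrArg φ.1 (simplexMix_zero _ _)
  map_one_left φ := Subtype.ext <| ContinuousMap.ext fun y =>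
    congrArg φ.1 (simplexMix_one _ _)

/-- The linear homotopy from the identity of the prism to the passage through the simplex. -/
def holinkPrismHomotopy (s : X → P) (h0 : I' 0 = p) (hJ : ∀ i, I' i.succ = J i) :
    (ContinuousMap.id (Holink (stratHolinkStrat s p) J)).Homotopy
      ((holinkToPrism s h0 hJ).comp (holinkOfPrism s h0 hJ)) where
  toContinuousMap := Holink.curryPrism s J
    ⟨fun z => (z.1.1.2.1 (simplexMix z.1.1.1 z.1.2
      (simplexCollapse (simplexCone z.1.2 z.2)))).1 z.2, by fun_prop⟩
    (fun z => (z.1.2.1 _).2.1)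
    (fun z t ht => by
      show s ((z.1.2.1 _).1 t) = _
      rw [Holink.strat_apply z.1.2 _ ht,
        maxSupp_simplexMix _ (maxSupp_simplexCollapse_simplexCone _ ht)]
      rfl)
  map_zero_left ψ := by
    ext x t
    exact congrArg (fun x => (ψ.1 x).1 t) (simplexMix_zero _ _)
  map_one_left ψ := by
    ext x t
    show (ψ.1 (simplexMix 1 _ _)).1 t = (ψ.1 _).1 (simplexHeight (simplexCone x t))
    rw [simplexMix_one, simplexHeight_simplexCone]

/-- The comparison of generalized homotopy links with those of stratified homotopy links. -/
lemma isWeakHomotopyEquiv_holinkCMap_iff {sX : X → P} {sY : Y → P} (w : C(X, Y))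
    (hw : ∀ x, sY (w x) = sX x) (h0 : I' 0 = p) (hJ : ∀ i, I' i.succ = J i) :
    IsWeakHomotopyEquiv (holinkCMap sX sY w hw I') ↔
      IsWeakHomotopyEquiv (holinkCMap (stratHolinkStrat sX p) (stratHolinkStrat sY p)
        (stratHolinkCMap w hw p) (stratHolinkCMap_strat w hw p) J) :=
  ⟨fun h => h.of_homotopy_retract (cA := holinkOfPrism sX h0 hJ) (jA := holinkToPrism sX h0 hJ)
      (cB := holinkOfPrism sY h0 hJ) (jB := holinkToPrism sY h0 hJ) rfl rfl
      (holinkPrismHomotopy sX h0 hJ) (holinkPrismHomotopy sY h0 hJ) fun _ _ => rfl,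
    fun h => h.of_homotopy_retract (cA := holinkToPrism sX h0 hJ) (jA := holinkOfPrism sX h0 hJ)
      (cB := holinkToPrism sY h0 hJ) (jB := holinkOfPrism sY h0 hJ) rfl rfl
      (holinkSimplexHomotopy sX h0 hJ) (holinkSimplexHomotopy sY h0 hJ) fun _ _ => rfl⟩

end HolinkComparison

section HolinkVertex

variable {P X Y : Type*} [TopologicalSpace X] [TopologicalSpace Y] {p : P}

/-- Evaluation at the unique point of the `0`-simplex. -/
def holinkToStratum (s : X → P) (K : Fin 1 → P) (h0 : K 0 = p) :
    C(Holink s K, {x : X // s x = p}) :=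
  ⟨fun φ => ⟨φ.1 (default : stdSimplex ℝ (Fin 1)),
      (φ.2 _).trans ((flagStrat_fin_one K _).trans h0)⟩,
    Continuous.subtype_mk
      ((continuous_eval_const (default : stdSimplex ℝ (Fin 1))).comp continuous_subtype_val) _⟩

/-- A point of a stratum, as a map from the `0`-simplex. -/
def holinkOfStratum (s : X → P) (K : Fin 1 → P) (h0 : K 0 = p) :
    C({x : X // s x = p}, Holink s K) :=
  Holink.curry s K ⟨fun z => z.1.1, by fun_prop⟩ fun z x => by
    rw [flagStrat_fin_one, h0]
    exact z.2

lemma holinkOfStratum_comp_holinkToStratum (s : X → P) (K : Fin 1 → P) (h0 : K 0 = p) :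
    (holinkOfStratum s K h0).comp (holinkToStratum s K h0) = ContinuousMap.id _ :=
  ContinuousMap.ext fun φ => Subtype.ext <| ContinuousMap.ext fun x =>
    congrArg φ.1 (Subsingleton.elim (α := stdSimplex ℝ (Fin 1)) _ x)

/-- The generalized homotopy link of a flag of length one is the stratum. -/
lemma isWeakHomotopyEquiv_holinkCMap_iff_stratumCMap {sX : X → P} {sY : Y → P} (w : C(X, Y))
    (hw : ∀ x, sY (w x) = sX x) {K : Fin 1 → P} (h0 : K 0 = p) :
    IsWeakHomotopyEquiv (holinkCMap sX sY w hw K) ↔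
      IsWeakHomotopyEquiv (stratumCMap sX sY w hw p) :=
  ⟨fun h => h.of_homotopy_retract (cA := holinkOfStratum sX K h0) (jA := holinkToStratum sX K h0)
      (cB := holinkOfStratum sY K h0) (jB := holinkToStratum sY K h0) rfl rfl
      (ContinuousMap.Homotopy.refl _) (ContinuousMap.Homotopy.refl _) fun _ _ => rfl,
    fun h => h.of_homotopy_retract (cA := holinkToStratum sX K h0) (jA := holinkOfStratum sX K h0)
      (cB := holinkToStratum sY K h0) (jB := holinkOfStratum sY K h0) rfl rfl
      ((ContinuousMap.Homotopy.refl _).cast rfl (holinkOfStratum_comp_holinkToStratum sX K h0).symm)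
      ((ContinuousMap.Homotopy.refl _).cast rfl (holinkOfStratum_comp_holinkToStratum sY K h0).symm)
      fun _ _ => rfl⟩

end HolinkVertex

/-- **Detecting diagrammatic equivalences on stratified homotopy links.** A stratified
map `w : X → Y` over `P` is a diagrammatic equivalence if and only if, for each
`p ∈ P`, the restriction `w_p : X_p → Y_p` is a weak homotopy equivalence and the
induced map `Hol^s_p(X) → Hol^s_p(Y)` is a diagrammatic equivalence over `P_{>p}`. -/
theorem diagEquiv_iff_strata_and_stratHolinks {P : Type} [PartialOrder P]
    {X Y : Type} [TopologicalSpace X] [TopologicalSpace Y]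
    (sX : X → P) (sY : Y → P) (hsX : AlexContinuous sX) (hsY : AlexContinuous sY)
    (w : C(X, Y)) (hw : ∀ x, sY (w x) = sX x) :
    IsDiagEquiv sX sY w hw ↔
      ∀ p : P,
        IsWeakHomotopyEquiv (stratumCMap sX sY w hw p) ∧
        IsDiagEquiv (stratHolinkStrat sX p) (stratHolinkStrat sY p)
          (stratHolinkCMap w hw p) (stratHolinkCMap_strat w hw p) := by
  constructor
  · refine fun h p => ⟨?_, fun m J hJ => ?_⟩
    · exact (isWeakHomotopyEquiv_holinkCMap_iff_stratumCMap w hw (K := fun _ => p) rfl).1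
        (h 0 _ (Subsingleton.strictMono (α := Fin 1) _))
    · refine (isWeakHomotopyEquiv_holinkCMap_iff w hw
        (I' := Fin.cons p fun i => (J i : P)) rfl fun _ => rfl).1 (h (m + 1) _ ?_)
      refine Fin.strictMono_iff_lt_succ.2 fun i => ?_
      cases i using Fin.cases with
      | zero => exact (J 0).2
      | succ i => exact hJ i.castSucc_lt_succ
  · rintro h (_ | m) K hK
    · exact (isWeakHomotopyEquiv_holinkCMap_iff_stratumCMap w hw rfl).2 (h (K 0)).1
    · exact (isWeakHomotopyEquiv_holinkCMap_iff w hw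
        (J := fun i => ⟨K i.succ, hK (Fin.succ_pos i)⟩) rfl fun _ => rfl).2
        ((h (K 0)).2 m _ fun i j hij => hK (Fin.succ_lt_succ_iff.2 hij))
end
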